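/- Let n be a positive integer, U ⊆ ℝ^{2n+1} open, A ⊆ U compact, and let (α_t)_{t∈[0,1]} be a family of smooth 1-forms on U, jointly continuous in (t, u) together with all spatial derivatives, such that each α_t is a contact form on U. Then there exist N ∈ ℕ, open balls B¹, …, B^N with closures contained in U, and functions r^l, s^l : [0,1] × ℝ^{2n+1} → ℝ (l = 1, …, N), jointly continuous together with all spatial derivatives, with each r^l_t = r^l(t, ·) and s^l_t = s^l(t, ·) smooth and compactly supported in B^l, such that for every t ∈ [0,1]: (1) α_t(u) = α_0(u) + Σ_{l=1}^N r^l_t(u)·D(s^l_t)(u) for every u ∈ A; and (2) for every j = 0, 1, …, N, the 1-form α_0 + Σ_{l=1}^j r^l_t · D(s^l_t) is a contact form at every point of A. Moreover, if V₀ ⊆ A is a compact set and α_t = α_0 on an open neighbourhood of V₀ for all t, then the functions r^l_t and s^l_t can all be chosen to vanish on a fixed open neighbourhood of V₀. -/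

import Mathlib

/-- `ℝ^{2n+1}`. -/
abbrev EucOdd (n : ℕ) : Type := (Fin n → ℝ) × (Fin n → ℝ) × ℝ

/-- The exterior derivative of a 1-form `A` (a map into the dual) at `u`:
`dA_u(v, w) = (DA(u)v)(w) − (DA(u)w)(v)`. -/
noncomputable def oneFormExtDeriv (n : ℕ) (A : EucOdd n → (EucOdd n →L[ℝ] ℝ))
    (u v w : EucOdd n) : ℝ :=
  fderiv ℝ A u v w - fderiv ℝ A u w v

/-- `A` is a contact form at `u`: `A u ≠ 0` and `dA_u` restricts to a nondegenerate form
on `ker (A u)`. -/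
noncomputable def IsContactFormAt (n : ℕ) (A : EucOdd n → (EucOdd n →L[ℝ] ℝ))
    (u : EucOdd n) : Prop :=
  A u ≠ 0 ∧ ∀ v : EucOdd n, A u v = 0 →
    (∀ w : EucOdd n, A u w = 0 → oneFormExtDeriv n A u v w = 0) → v = 0

open Filter Topology Set

section JointContinuity

variable {X E F G : Type*} [TopologicalSpace X] [NormedAddCommGroup E] [NormedSpace ℝ E]
  [NormedAddCommGroup F] [NormedSpace ℝ F] [NormedAddCommGroup G] [NormedSpace ℝ G]

theorem continuousOn_iteratedFDeriv_cutoff_smul {S : Set X} {U : Set E} (hU : IsOpen U)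
    {φ : E → ℝ} (hφ : ContDiff ℝ (⊤ : ℕ∞) φ) (hφU : tsupport φ ⊆ U) {f : X → E → F}
    (hf : ∀ t ∈ S, ContDiffOn ℝ (⊤ : ℕ∞) (f t) U)
    (hfc : ∀ k : ℕ, ContinuousOn (fun q : X × E => iteratedFDeriv ℝ k (f q.1) q.2) (S ×ˢ U))
    (k : ℕ) :
    ContinuousOn (fun q : X × E => iteratedFDeriv ℝ k (fun u => φ u • f q.1 u) q.2)
      (S ×ˢ univ) := by
  rintro ⟨t₀, u₀⟩ ⟨ht₀, -⟩
  have ht₀ : t₀ ∈ S := ht₀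
  by_cases hu₀ : u₀ ∈ tsupport φ
  swap
  · have hev : ∀ᶠ q : X × E in 𝓝 (t₀, u₀), q.2 ∈ (tsupport φ)ᶜ :=
      continuous_snd.continuousAt.eventually ((isClosed_tsupport φ).isOpen_compl.mem_nhds hu₀)
    refine ContinuousAt.continuousWithinAt ((continuousAt_const (y := 0)).congr ?_)
    filter_upwards [hev] with q hq
    have h0 : (fun u => φ u • f q.1 u) =ᶠ[𝓝 q.2] fun _ => (0 : F) := by
      filter_upwards [(isClosed_tsupport φ).isOpen_compl.mem_nhds hq] with u hu
      rw [image_eq_zero_of_notMem_tsupport hu, zero_smul]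
    rw [(h0.iteratedFDeriv ℝ k).eq_of_nhds]
    simp
  have hu₀U := hφU hu₀
  have hG : ∀ t ∈ S, ContDiffOn ℝ (⊤ : ℕ∞) (fun u => φ u • f t u) U := fun t ht =>
    hφ.contDiffOn.smul (hf t ht)
  have hcont : ∀ (j : ℕ) {g : E → F}, ContDiffOn ℝ (⊤ : ℕ∞) g U →
      ContinuousAt (iteratedFDeriv ℝ j g) u₀ := fun j g hg =>
    ((hg.continuousOn_iteratedFDerivWithin (mod_cast le_top) hU.uniqueDiffOn).congr
      (fun x hx => (iteratedFDerivWithin_of_isOpen j hU hx).symm)).continuousAt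
      (hU.mem_nhds hu₀U)
  have hdiff : ∀ j : ℕ, Tendsto (fun q : X × E =>
      iteratedFDeriv ℝ j (fun u => f q.1 u - f t₀ u) q.2) (𝓝[S ×ˢ U] (t₀, u₀)) (𝓝 0) := by
    intro j
    have h1 := hfc j (t₀, u₀) ⟨ht₀, hu₀U⟩
    have h2 : Tendsto (fun q : X × E => iteratedFDeriv ℝ j (f t₀) q.2)
        (𝓝[S ×ˢ U] (t₀, u₀)) (𝓝 (iteratedFDeriv ℝ j (f t₀) u₀)) :=
      ((hcont j (hf t₀ ht₀)).tendsto.comp (continuous_snd.tendsto (t₀, u₀))).mono_left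
        nhdsWithin_le_nhds
    have h3 := Tendsto.sub h1 h2
    simp only [sub_self] at h3
    refine h3.congr' ?_
    filter_upwards [self_mem_nhdsWithin] with q hq
    rw [fun_iteratedFDeriv_sub_apply]
    · exact ((hf q.1 hq.1).contDiffAt (hU.mem_nhds hq.2)).of_le (mod_cast le_top)
    · exact ((hf t₀ ht₀).contDiffAt (hU.mem_nhds hq.2)).of_le (mod_cast le_top)
  have hprod : Tendsto (fun q : X × E =>
      iteratedFDeriv ℝ k (fun u => φ u • (f q.1 u - f t₀ u)) q.2)
      (𝓝[S ×ˢ U] (t₀, u₀)) (𝓝 0) := by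
    have hbound : Tendsto (fun q : X × E => ∑ i ∈ Finset.range (k + 1),
        (k.choose i : ℝ) * ‖iteratedFDeriv ℝ i φ q.2‖ *
          ‖iteratedFDeriv ℝ (k - i) (fun u => f q.1 u - f t₀ u) q.2‖)
        (𝓝[S ×ˢ U] (t₀, u₀)) (𝓝 0) := by
      have hterm : ∀ i ∈ Finset.range (k + 1), Tendsto (fun q : X × E =>
          (k.choose i : ℝ) * ‖iteratedFDeriv ℝ i φ q.2‖ *
            ‖iteratedFDeriv ℝ (k - i) (fun u => f q.1 u - f t₀ u) q.2‖)
          (𝓝[S ×ˢ U] (t₀, u₀)) (𝓝 0) := by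
        intro i _
        have h1 : Continuous fun q : X × E => (k.choose i : ℝ) * ‖iteratedFDeriv ℝ i φ q.2‖ :=
          continuous_const.mul ((hφ.continuous_iteratedFDeriv (m := i) (mod_cast le_top)).norm.comp
            continuous_snd)
        have h2 : Tendsto (fun q : X × E =>
            ‖iteratedFDeriv ℝ (k - i) (fun u => f q.1 u - f t₀ u) q.2‖)
            (𝓝[S ×ˢ U] (t₀, u₀)) (𝓝 0) := tendsto_zero_iff_norm_tendsto_zero.1 (hdiff _)
        have h3 := ((h1.tendsto (t₀, u₀)).mono_left nhdsWithin_le_nhds).mul h2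
        rwa [mul_zero] at h3
      have hsum := tendsto_finsetSum _ hterm
      rwa [Finset.sum_const_zero] at hsum
    refine squeeze_zero_norm' ?_ hbound
    filter_upwards [self_mem_nhdsWithin] with q hq
    have := norm_iteratedFDerivWithin_smul_le (n := k) (N := (⊤ : ℕ∞)) hφ.contDiffOn
      ((hf q.1 hq.1).sub (hf t₀ ht₀)) hU.uniqueDiffOn hq.2 (mod_cast le_top)
    simpa only [iteratedFDerivWithin_of_isOpen _ hU hq.2, Pi.sub_apply] using this
  have hmain : Tendsto (fun q : X × E => iteratedFDeriv ℝ k (fun u => φ u • f q.1 u) q.2)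
      (𝓝[S ×ˢ U] (t₀, u₀)) (𝓝 (iteratedFDeriv ℝ k (fun u => φ u • f t₀ u) u₀)) := by
    have h2 : Tendsto (fun q : X × E => iteratedFDeriv ℝ k (fun u => φ u • f t₀ u) q.2)
        (𝓝[S ×ˢ U] (t₀, u₀)) (𝓝 (iteratedFDeriv ℝ k (fun u => φ u • f t₀ u) u₀)) :=
      ((hcont k (hG t₀ ht₀)).tendsto.comp (continuous_snd.tendsto (t₀, u₀))).mono_left
        nhdsWithin_le_nhds
    have h3 := hprod.add h2
    rw [zero_add] at h3
    refine h3.congr' ?_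
    filter_upwards [self_mem_nhdsWithin] with q hq
    simp only [smul_sub]
    rw [fun_iteratedFDeriv_sub_apply, sub_add_cancel]
    · exact ((hG q.1 hq.1).contDiffAt (hU.mem_nhds hq.2)).of_le (mod_cast le_top)
    · exact ((hG t₀ ht₀).contDiffAt (hU.mem_nhds hq.2)).of_le (mod_cast le_top)
  refine ContinuousWithinAt.mono_of_mem_nhdsWithin (t := S ×ˢ U) hmain ?_
  filter_upwards [self_mem_nhdsWithin, mem_nhdsWithin_of_mem_nhds
    (continuous_snd.continuousAt.eventually (hU.mem_nhds hu₀U))] with q hq hqU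
  exact ⟨hq.1, hqU⟩

theorem contDiff_cutoff_smul {U : Set E} (hU : IsOpen U)
    {φ : E → ℝ} (hφ : ContDiff ℝ (⊤ : ℕ∞) φ) (hφU : tsupport φ ⊆ U) {f : E → F}
    (hf : ContDiffOn ℝ (⊤ : ℕ∞) f U) : ContDiff ℝ (⊤ : ℕ∞) (fun u => φ u • f u) := by
  refine contDiff_iff_contDiffAt.2 fun x => ?_
  by_cases hx : x ∈ tsupport φ
  · exact hφ.contDiffAt.smul (hf.contDiffAt (hU.mem_nhds (hφU hx)))
  · refine (contDiffAt_const (c := (0 : F))).congr_of_eventuallyEq ?_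
    filter_upwards [(isClosed_tsupport φ).isOpen_compl.mem_nhds hx] with u hu
    rw [image_eq_zero_of_notMem_tsupport hu, zero_smul]

theorem continuousOn_iteratedFDeriv_clm_comp_sub {S : Set X} {U : Set E} (hU : IsOpen U)
    (L : F →L[ℝ] G) {f g : X → E → F}
    (hf : ∀ t ∈ S, ContDiffOn ℝ (⊤ : ℕ∞) (f t) U)
    (hg : ∀ t ∈ S, ContDiffOn ℝ (⊤ : ℕ∞) (g t) U)
    (hfc : ∀ k : ℕ, ContinuousOn (fun q : X × E => iteratedFDeriv ℝ k (f q.1) q.2) (S ×ˢ U))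
    (hgc : ∀ k : ℕ, ContinuousOn (fun q : X × E => iteratedFDeriv ℝ k (g q.1) q.2) (S ×ˢ U))
    (k : ℕ) :
    ContinuousOn (fun q : X × E => iteratedFDeriv ℝ k (fun u => L (f q.1 u - g q.1 u)) q.2)
      (S ×ˢ U) := by
  have h := ((hfc k).sub (hgc k))
  refine ((ContinuousLinearMap.compContinuousMultilinearMapL ℝ (fun _ : Fin k => E) F G
    L).continuous.comp_continuousOn h).congr fun q hq => ?_
  have h1 : ContDiffAt ℝ k (f q.1) q.2 :=
    ((hf q.1 hq.1).contDiffAt (hU.mem_nhds hq.2)).of_le (mod_cast le_top)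
  have h2 : ContDiffAt ℝ k (g q.1) q.2 :=
    ((hg q.1 hq.1).contDiffAt (hU.mem_nhds hq.2)).of_le (mod_cast le_top)
  have := L.iteratedFDeriv_comp_left (h1.sub h2) le_rfl
  rw [fun_iteratedFDeriv_sub_apply h1 h2] at this
  exact this

theorem continuousOn_uncurry_of_iteratedFDeriv {S : Set X} {U : Set E} {f : X → E → F}
    (hfc : ContinuousOn (fun q : X × E => iteratedFDeriv ℝ 0 (f q.1) q.2) (S ×ˢ U)) :
    ContinuousOn (fun q : X × E => f q.1 q.2) (S ×ˢ U) :=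
  (ContinuousMultilinearMap.apply ℝ (fun _ : Fin 0 => E) F 0).continuous.comp_continuousOn hfc

theorem continuousOn_fderiv_of_iteratedFDeriv [FiniteDimensional ℝ E] {S : Set X} {U : Set E}
    {f : X → E → F}
    (hfc : ContinuousOn (fun q : X × E => iteratedFDeriv ℝ 1 (f q.1) q.2) (S ×ˢ U)) :
    ContinuousOn (fun q : X × E => fderiv ℝ (f q.1) q.2) (S ×ˢ U) := by
  refine continuousOn_clm_apply.2 fun v => ?_
  refine ((ContinuousMultilinearMap.apply ℝ (fun _ : Fin 1 => E) F
    (fun _ => v)).continuous.comp_continuousOn hfc).congr fun q _ => ?_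
  exact (iteratedFDeriv_one_apply (𝕜 := ℝ) (f := f q.1) (x := q.2) (fun _ => v)).symm

end JointContinuity

section ContactPair

variable {E : Type*} [NormedAddCommGroup E] [NormedSpace ℝ E]

/-- The pointwise contact condition on the value `p` and the derivative `q` of a 1-form. -/
def IsContactPair (x : (E →L[ℝ] ℝ) × (E →L[ℝ] E →L[ℝ] ℝ)) : Prop :=
  x.1 ≠ 0 ∧ ∀ v, x.1 v = 0 → (∀ w, x.1 w = 0 → x.2 v w - x.2 w v = 0) → v = 0

/-- The bundled form `(v, c) ↦ (ω(v, ·) - c p, p v)`, where `ω` is the antisymmetrization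
of `q`. -/
noncomputable def contactExtension (x : (E →L[ℝ] ℝ) × (E →L[ℝ] E →L[ℝ] ℝ)) :
    E × ℝ →L[ℝ] (E →L[ℝ] ℝ) × ℝ :=
  ((x.2 - x.2.flip).coprod (-(ContinuousLinearMap.toSpanSingleton ℝ x.1))).prod
    (x.1.comp (ContinuousLinearMap.fst ℝ E ℝ))

theorem contactExtension_apply (x : (E →L[ℝ] ℝ) × (E →L[ℝ] E →L[ℝ] ℝ)) (y : E × ℝ) :
    contactExtension x y = (x.2 y.1 - x.2.flip y.1 - y.2 • x.1, x.1 y.1) := by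
  simp [contactExtension, sub_eq_add_neg]

theorem isContactPair_iff_injective (x : (E →L[ℝ] ℝ) × (E →L[ℝ] E →L[ℝ] ℝ)) :
    IsContactPair x ↔ Function.Injective (contactExtension x) := by
  rw [injective_iff_map_eq_zero]
  constructor
  · rintro ⟨h0, h⟩ ⟨v, c⟩ hvc
    rw [contactExtension_apply, Prod.mk_eq_zero] at hvc
    obtain ⟨h1, h2⟩ := hvc
    have hv : v = 0 := h v h2 fun w hw => by
      simpa [hw] using DFunLike.congr_fun h1 w
    subst hv
    simpa [h0] using h1
  · intro h
    refine ⟨fun h0 => ?_, fun v hv hω => ?_⟩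
    · have := h (0, 1) (by rw [contactExtension_apply]; simp [h0])
      simp at this
    · have hker : (x.1 : E →ₗ[ℝ] ℝ).ker ≤ ((x.2 v - x.2.flip v : E →L[ℝ] ℝ) : E →ₗ[ℝ] ℝ).ker :=
        fun w hw => hω w hw
      have hspan := mem_span_of_iInf_ker_le_ker (ι := Unit)
        (L := fun _ => (x.1 : E →ₗ[ℝ] ℝ)) (by simpa using hker)
      rw [range_const, Submodule.mem_span_singleton] at hspan
      obtain ⟨c, hc⟩ := hspan
      have := h (v, c) (by
        rw [contactExtension_apply, Prod.mk_eq_zero]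
        refine ⟨?_, hv⟩
        ext w
        have := LinearMap.congr_fun hc w
        simp at this
        simp [this])
      exact congrArg Prod.fst this

theorem isOpen_setOf_isContactPair [FiniteDimensional ℝ E] :
    IsOpen {x : (E →L[ℝ] ℝ) × (E →L[ℝ] E →L[ℝ] ℝ) | IsContactPair x} := by
  simp only [isContactPair_iff_injective]
  refine ContinuousLinearMap.isOpen_injective.preimage ?_
  refine continuous_clm_apply.2 fun y => ?_
  simp only [contactExtension_apply]
  have hflip : Continuous fun x : (E →L[ℝ] ℝ) × (E →L[ℝ] E →L[ℝ] ℝ) => x.2.flip :=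
    (ContinuousLinearMap.flipₗᵢ ℝ E E ℝ).continuous.comp continuous_snd
  fun_prop

end ContactPair

section PrimitivePartition

variable {E : Type*} [NormedAddCommGroup E] [NormedSpace ℝ E] [FiniteDimensional ℝ E]

theorem exists_contDiff_eventually_one_of_isCompact {C O : Set E} (hC : IsCompact C)
    (hO : IsOpen O) (hCO : C ⊆ O) :
    ∃ ψ : E → ℝ, ContDiff ℝ (⊤ : ℕ∞) ψ ∧ tsupport ψ ⊆ O ∧ ∀ u ∈ C, ψ =ᶠ[𝓝 u] 1 := by
  obtain ⟨L, hL, hCL, hLO⟩ := exists_compact_between hC hO hCO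
  obtain ⟨ψ, hψ1, hψ0, -⟩ := exists_contMDiffMap_one_nhds_of_subset_interior (n := (⊤ : ℕ∞))
    (modelWithCornersSelf ℝ E) hC.isClosed hCL
  refine ⟨ψ, ψ.contMDiff.contDiff, ?_, fun u hu => ?_⟩
  · refine (closure_minimal (fun u hu => ?_) hL.isClosed).trans hLO
    by_contra h
    exact hu (hψ0 u h)
  · exact eventually_nhdsSet_iff_forall.1 hψ1 u hu

theorem exists_finite_ball_partition {A U : Set E} (hA : IsCompact A) (hU : IsOpen U)
    (hAU : A ⊆ U) :
    ∃ (ι : Type) (_ : Fintype ι) (c : ι → E) (ρ : ι → ℝ) (φ : ι → E → ℝ),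
      (∀ m, 0 < ρ m ∧ closure (Metric.ball (c m) (ρ m)) ⊆ U ∧ ContDiff ℝ (⊤ : ℕ∞) (φ m) ∧
        tsupport (φ m) ⊆ Metric.ball (c m) (ρ m)) ∧
      ∀ u ∈ A, ∑ m, φ m u = 1 := by
  have hr : ∀ a : A, ∃ r : ℝ, 0 < r ∧ closure (Metric.ball (a : E) r) ⊆ U := fun a => by
    obtain ⟨r, hr, hrU⟩ := Metric.nhds_basis_closedBall.mem_iff.1 (hU.mem_nhds (hAU a.2))
    exact ⟨r, hr, Metric.closure_ball_subset_closedBall.trans hrU⟩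
  choose r hr hrU using hr
  obtain ⟨T, hT⟩ := hA.elim_finite_subcover (fun a : A => Metric.ball (a : E) (r a))
    (fun _ => Metric.isOpen_ball)
    (fun a ha => mem_iUnion.2 ⟨⟨a, ha⟩, Metric.mem_ball_self (hr _)⟩)
  let e := T.equivFin
  obtain ⟨f, hf⟩ := SmoothPartitionOfUnity.exists_isSubordinate (modelWithCornersSelf ℝ E)
    hA.isClosed (fun m : Fin T.card => Metric.ball ((e.symm m).1 : E) (r (e.symm m).1))
    (fun _ => Metric.isOpen_ball) (fun u hu => by
      obtain ⟨a, haT, hau⟩ := mem_iUnion₂.1 (hT hu)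
      refine mem_iUnion.2 ⟨e ⟨a, haT⟩, ?_⟩
      simpa using hau)
  refine ⟨Fin T.card, inferInstance, fun m => (e.symm m).1, fun m => r (e.symm m).1,
    fun m => f m, fun m => ⟨hr _, hrU _, (f m).contMDiff.contDiff, hf m⟩, fun u hu => ?_⟩
  rw [← finsum_eq_sum_of_fintype]
  exact f.sum_eq_one hu

theorem exists_primitive_partition {A U V₀ W : Set E} (hA : IsCompact A) (hU : IsOpen U)
    (hAU : A ⊆ U) (hV₀ : IsCompact V₀) (hW : IsOpen W) (hV₀W : V₀ ⊆ W) :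
    ∃ (O W' : Set E) (ι : Type) (_ : Fintype ι) (c : ι → E) (ρ : ι → ℝ) (φ σ : ι → E → ℝ)
      (v : ι → E), (IsOpen O ∧ A ⊆ O) ∧ (IsOpen W' ∧ V₀ ⊆ W' ∧ W' ⊆ W) ∧
      (∀ x, 0 < ρ x ∧ closure (Metric.ball (c x) (ρ x)) ⊆ U ∧ ContDiff ℝ (⊤ : ℕ∞) (φ x) ∧
        ContDiff ℝ (⊤ : ℕ∞) (σ x) ∧ tsupport (φ x) ⊆ Metric.ball (c x) (ρ x) ∧
        tsupport (σ x) ⊆ Metric.ball (c x) (ρ x) ∧ ∀ u ∈ W', σ x u = 0) ∧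
      ∀ u ∈ O, ∀ p : E →L[ℝ] ℝ, (u ∈ W → p = 0) →
        ∑ x, (φ x u * p (v x)) • fderiv ℝ (σ x) u = p := by
  obtain ⟨K, hK, hV₀K, hKW⟩ := exists_compact_between hV₀ hW hV₀W
  obtain ⟨A', hA', hAA', hA'U⟩ := exists_compact_between hA hU hAU
  obtain ⟨ι, _, c, ρ, φ, hφ, hsum⟩ := exists_finite_ball_partition hA' hU hA'U
  have hψ : ∀ m, ∃ ψ : E → ℝ, ContDiff ℝ (⊤ : ℕ∞) ψ ∧ tsupport ψ ⊆ Metric.ball (c m) (ρ m) \ K ∧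
      ∀ u ∈ tsupport (φ m) \ W, ψ =ᶠ[𝓝 u] 1 := fun m => by
    refine exists_contDiff_eventually_one_of_isCompact ?_ (Metric.isOpen_ball.sdiff hK.isClosed)
      (fun u hu => ⟨(hφ m).2.2.2 hu.1, fun h => hu.2 (hKW h)⟩)
    exact Metric.isCompact_of_isClosed_isBounded ((isClosed_tsupport _).sdiff hW)
      (Metric.isBounded_ball.subset (sdiff_subset.trans (hφ m).2.2.2))
  choose ψ hψ hψs hψ1 using hψ
  let b := Module.finBasis ℝ E
  let coord : Fin (Module.finrank ℝ E) → E →L[ℝ] ℝ := fun k =>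
    LinearMap.toContinuousLinearMap (b.coord k)
  have htσ : ∀ (m : ι) k, tsupport (fun u => ψ m u * coord k u) ⊆ tsupport (ψ m) := fun m k =>
    tsupport_mul_subset_left
  refine ⟨interior A', interior K, ι × Fin (Module.finrank ℝ E), inferInstance, fun x => c x.1,
    fun x => ρ x.1, fun x => φ x.1, fun x u => ψ x.1 u * coord x.2 u, fun x => b x.2,
    ⟨isOpen_interior, hAA'⟩, ⟨isOpen_interior, hV₀K, interior_subset.trans hKW⟩,
    fun x => ⟨(hφ x.1).1, (hφ x.1).2.1, (hφ x.1).2.2.1, (hψ x.1).mul (coord x.2).contDiff,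
      (hφ x.1).2.2.2, ?_, ?_⟩, ?_⟩
  · exact (htσ x.1 x.2).trans ((hψs x.1).trans sdiff_subset)
  · intro u hu
    have : u ∉ tsupport (ψ x.1) := fun h => (hψs x.1 h).2 (interior_subset hu)
    simp [image_eq_zero_of_notMem_tsupport this]
  · intro u hu p hp
    by_cases huW : u ∈ W
    · simp [hp huW]
    have hcoord : ∑ k, p (b k) • coord k = p := by
      ext w
      conv_rhs => rw [← b.sum_repr w]
      simp [coord, map_sum, mul_comm, -Module.Basis.sum_repr]
    rw [Fintype.sum_prod_type]
    have hm : ∀ m, ∑ k, (φ m u * p (b k)) • fderiv ℝ (fun u => ψ m u * coord k u) u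
        = φ m u • p := by
      intro m
      by_cases hmu : u ∈ tsupport (φ m)
      · have hd : ∀ k, fderiv ℝ (fun u => ψ m u * coord k u) u = coord k := fun k => by
          have : (fun u => ψ m u * coord k u) =ᶠ[𝓝 u] coord k := by
            filter_upwards [hψ1 m u ⟨hmu, huW⟩] with y hy
            simp [hy]
          rw [this.fderiv_eq, ContinuousLinearMap.fderiv]
        simp only [hd, mul_smul, ← Finset.smul_sum, hcoord]
      · simp [image_eq_zero_of_notMem_tsupport hmu]
    simp only [hm, ← Finset.sum_smul, hsum u (interior_subset hu), one_smul]

theorem exists_primitive_partition_nat {A U V₀ W : Set E} (hA : IsCompact A) (hU : IsOpen U)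
    (hAU : A ⊆ U) (hV₀ : IsCompact V₀) (hW : IsOpen W) (hV₀W : V₀ ⊆ W) :
    ∃ (O W' : Set E) (Q : ℕ) (c : ℕ → E) (ρ : ℕ → ℝ) (φ σ : ℕ → E → ℝ)
      (v : ℕ → E), (IsOpen O ∧ A ⊆ O) ∧ (IsOpen W' ∧ V₀ ⊆ W' ∧ W' ⊆ W) ∧
      (∀ x < Q, 0 < ρ x ∧ closure (Metric.ball (c x) (ρ x)) ⊆ U ∧ ContDiff ℝ (⊤ : ℕ∞) (φ x) ∧
        ContDiff ℝ (⊤ : ℕ∞) (σ x) ∧ tsupport (φ x) ⊆ Metric.ball (c x) (ρ x) ∧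
        tsupport (σ x) ⊆ Metric.ball (c x) (ρ x) ∧ ∀ u ∈ W', σ x u = 0) ∧
      ∀ u ∈ O, ∀ p : E →L[ℝ] ℝ, (u ∈ W → p = 0) →
        ∑ x ∈ Finset.range Q, (φ x u * p (v x)) • fderiv ℝ (σ x) u = p := by
  obtain ⟨O, W', ι, _, c, ρ, φ, σ, v, hO, hW', h, hsum⟩ :=
    exists_primitive_partition hA hU hAU hV₀ hW hV₀W
  cases isEmpty_or_nonempty ι with
  | inl _ =>
    exact ⟨O, W', 0, 0, 0, 0, 0, 0, hO, hW', by simp, fun u hu p hp => by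
      simpa using hsum u hu p hp⟩
  | inr hne =>
    let e := Fintype.equivFin ι
    let g : ℕ → ι := fun x => if hx : x < Fintype.card ι then e.symm ⟨x, hx⟩ else hne.some
    have hg : ∀ x : Fin (Fintype.card ι), g x = e.symm x := fun x => dif_pos x.2
    refine ⟨O, W', Fintype.card ι, fun x => c (g x), fun x => ρ (g x), fun x => φ (g x),
      fun x => σ (g x), fun x => v (g x), hO, hW', fun x _ => h (g x), fun u hu p hp => ?_⟩
    rw [Finset.sum_range]
    simp only [hg]
    rw [e.symm.sum_comp fun x => (φ x u * p (v x)) • fderiv ℝ (σ x) u]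
    exact hsum u hu p hp

end PrimitivePartition

section PrimitivePartialSum

variable {E : Type*} [NormedAddCommGroup E] [NormedSpace ℝ E]

/-- The operator `p ↦ ∑_{x < j} φ_x p(v_x) dσ_x` on 1-forms. -/
noncomputable def primitivePartialSum (φ σ : ℕ → E → ℝ) (v : ℕ → E) (j : ℕ) (u : E) :
    (E →L[ℝ] ℝ) →L[ℝ] (E →L[ℝ] ℝ) :=
  ∑ x ∈ Finset.range j,
    φ x u • (ContinuousLinearMap.apply ℝ ℝ (v x)).smulRight (fderiv ℝ (σ x) u)

theorem primitivePartialSum_apply (φ σ : ℕ → E → ℝ) (v : ℕ → E) (j : ℕ) (u : E)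
    (p : E →L[ℝ] ℝ) :
    primitivePartialSum φ σ v j u p =
      ∑ x ∈ Finset.range j, (φ x u * p (v x)) • fderiv ℝ (σ x) u := by
  simp [primitivePartialSum, mul_smul]

set_option maxSynthPendingDepth 3 in
theorem contDiff_primitivePartialSum {φ σ : ℕ → E → ℝ} (v : ℕ → E) {j : ℕ}
    (hφ : ∀ x < j, ContDiff ℝ (⊤ : ℕ∞) (φ x)) (hσ : ∀ x < j, ContDiff ℝ (⊤ : ℕ∞) (σ x)) :
    ContDiff ℝ (⊤ : ℕ∞) (primitivePartialSum φ σ v j) := by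
  unfold primitivePartialSum
  refine ContDiff.sum fun x hx => (hφ x (Finset.mem_range.1 hx)).smul ?_
  exact contDiff_const.smulRight ((hσ x (Finset.mem_range.1 hx)).fderiv_right (by simp))

end PrimitivePartialSum

section ContactStep

variable {E : Type*} [NormedAddCommGroup E] [NormedSpace ℝ E] [FiniteDimensional ℝ E]

set_option maxSynthPendingDepth 3 in
theorem exists_uniform_contact_step {A U : Set E} (hA : IsCompact A) (hU : IsOpen U)
    (hAU : A ⊆ U) {I : Set ℝ} (hI : IsCompact I) {α : ℝ → E → E →L[ℝ] ℝ}
    (hsm : ∀ t ∈ I, ContDiffOn ℝ (⊤ : ℕ∞) (α t) U)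
    (hck : ∀ k : ℕ, ContinuousOn (fun q : ℝ × E => iteratedFDeriv ℝ k (α q.1) q.2) (I ×ˢ U))
    (hcontact : ∀ t ∈ I, ∀ u ∈ A, IsContactPair (α t u, fderiv ℝ (α t) u))
    {P : E → (E →L[ℝ] ℝ) →L[ℝ] (E →L[ℝ] ℝ)} (hP : ContDiff ℝ (⊤ : ℕ∞) P) :
    ∃ δ > 0, ∀ τ ∈ I, ∀ t ∈ I, |t - τ| < δ → ∀ u ∈ A,
      IsContactPair (α τ u + P u (α t u - α τ u),
        fderiv ℝ (fun y => α τ y + P y (α t y - α τ y)) u) := by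
  let D : ℝ × ℝ × E → E →L[ℝ] E →L[ℝ] ℝ := fun q =>
    fderiv ℝ (α q.1) q.2.2 + ((P q.2.2).comp (fderiv ℝ (α q.2.1) q.2.2 - fderiv ℝ (α q.1) q.2.2) +
      (fderiv ℝ P q.2.2).flip (α q.2.1 q.2.2 - α q.1 q.2.2))
  let H : ℝ × ℝ × E → (E →L[ℝ] ℝ) × (E →L[ℝ] E →L[ℝ] ℝ) := fun q =>
    (α q.1 q.2.2 + P q.2.2 (α q.2.1 q.2.2 - α q.1 q.2.2), D q)
  have hD : ∀ τ ∈ I, ∀ t ∈ I, ∀ u ∈ A,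
      fderiv ℝ (fun y => α τ y + P y (α t y - α τ y)) u = D (τ, t, u) := by
    intro τ hτ t ht u hu
    have hd : ∀ t ∈ I, HasFDerivAt (α t) (fderiv ℝ (α t) u) u := fun t ht =>
      (((hsm t ht).contDiffAt (hU.mem_nhds (hAU hu))).differentiableAt (by simp)).hasFDerivAt
    exact ((hd τ hτ).add (((hP.differentiable (by simp)) u).hasFDerivAt.clm_apply
      ((hd t ht).sub (hd τ hτ)))).fderiv
  have hH : ContinuousOn H (I ×ˢ I ×ˢ A) := by
    have hα := continuousOn_uncurry_of_iteratedFDeriv (hck 0)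
    have hdα := continuousOn_fderiv_of_iteratedFDeriv (hck 1)
    have m1 : MapsTo (fun q : ℝ × ℝ × E => (q.1, q.2.2)) (I ×ˢ I ×ˢ A) (I ×ˢ U) :=
      fun q hq => ⟨hq.1, hAU hq.2.2⟩
    have m2 : MapsTo (fun q : ℝ × ℝ × E => (q.2.1, q.2.2)) (I ×ˢ I ×ˢ A) (I ×ˢ U) :=
      fun q hq => ⟨hq.2.1, hAU hq.2.2⟩
    have c1 : ContinuousOn (fun q : ℝ × ℝ × E => α q.1 q.2.2) (I ×ˢ I ×ˢ A) :=
      hα.comp (by fun_prop) m1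
    have c2 : ContinuousOn (fun q : ℝ × ℝ × E => α q.2.1 q.2.2) (I ×ˢ I ×ˢ A) :=
      hα.comp (by fun_prop) m2
    have d1 : ContinuousOn (fun q : ℝ × ℝ × E => fderiv ℝ (α q.1) q.2.2) (I ×ˢ I ×ˢ A) :=
      hdα.comp (by fun_prop) m1
    have d2 : ContinuousOn (fun q : ℝ × ℝ × E => fderiv ℝ (α q.2.1) q.2.2) (I ×ˢ I ×ˢ A) :=
      hdα.comp (by fun_prop) m2
    have p1 : ContinuousOn (fun q : ℝ × ℝ × E => P q.2.2) (I ×ˢ I ×ˢ A) :=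
      (hP.continuous.comp (by fun_prop)).continuousOn
    have p2 : ContinuousOn (fun q : ℝ × ℝ × E => (fderiv ℝ P q.2.2).flip) (I ×ˢ I ×ˢ A) :=
      ((ContinuousLinearMap.flipₗᵢ ℝ E (E →L[ℝ] ℝ) (E →L[ℝ] ℝ)).continuous.comp
        ((hP.continuous_fderiv (by simp)).comp (by fun_prop))).continuousOn
    exact (c1.add (p1.clm_apply (c2.sub c1))).prodMk
      (d1.add ((p1.clm_comp (d2.sub d1)).add (p2.clm_apply (c2.sub c1))))
  have hB : IsCompact ((I ×ˢ I ×ˢ A) ∩ H ⁻¹' {x | IsContactPair x}ᶜ) := by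
    have hK : IsCompact (I ×ˢ I ×ˢ A) := hI.prod (hI.prod hA)
    exact hK.of_isClosed_subset (hH.preimage_isClosed_of_isClosed hK.isClosed
      isOpen_setOf_isContactPair.isClosed_compl) inter_subset_left
  have himage := (hB.image (f := fun q : ℝ × ℝ × E => q.2.1 - q.1) (by fun_prop)).isClosed
  have h0 : (0 : ℝ) ∉ (fun q : ℝ × ℝ × E => q.2.1 - q.1) ''
      ((I ×ˢ I ×ˢ A) ∩ H ⁻¹' {x | IsContactPair x}ᶜ) := by
    rintro ⟨⟨τ, t, u⟩, ⟨⟨hτ, ht, hu⟩, hbad⟩, h⟩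
    obtain rfl : t = τ := sub_eq_zero.1 h
    refine hbad ?_
    simpa [H, D] using hcontact t hτ u hu
  obtain ⟨δ, hδ, hball⟩ := Metric.isOpen_iff.1 himage.isOpen_compl 0 h0
  refine ⟨δ, hδ, fun τ hτ t ht htτ u hu => ?_⟩
  rw [hD τ hτ t ht u hu]
  by_contra hbad
  exact hball (show t - τ ∈ Metric.ball 0 δ by simpa using htτ) ⟨(τ, t, u), ⟨⟨hτ, ht, hu⟩, hbad⟩, rfl⟩

end ContactStep

section Telescoping

variable {E : Type*} [NormedAddCommGroup E] [NormedSpace ℝ E]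

theorem sum_range_mul_add_primitive {φ σ : ℕ → E → ℝ} {v : ℕ → E} {Q : ℕ} {u : E}
    (β : ℕ → E →L[ℝ] ℝ) (hfull : ∀ i, primitivePartialSum φ σ v Q u (β (i + 1) - β i) =
      β (i + 1) - β i) (i : ℕ) {j : ℕ} (hj : j ≤ Q) :
    ∑ l ∈ Finset.range (i * Q + j),
        (φ (l % Q) u • (β (l / Q + 1) - β (l / Q)) (v (l % Q))) • fderiv ℝ (σ (l % Q)) u =
      β i - β 0 + primitivePartialSum φ σ v j u (β (i + 1) - β i) := by
  have hblock : ∀ (i : ℕ) {j : ℕ}, j ≤ Q → ∑ x ∈ Finset.range j,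
      (φ ((i * Q + x) % Q) u • (β ((i * Q + x) / Q + 1) - β ((i * Q + x) / Q))
        (v ((i * Q + x) % Q))) • fderiv ℝ (σ ((i * Q + x) % Q)) u =
      primitivePartialSum φ σ v j u (β (i + 1) - β i) := by
    intro i j hj
    rw [primitivePartialSum_apply]
    refine Finset.sum_congr rfl fun x hx => ?_
    have hxQ : x < Q := (Finset.mem_range.1 hx).trans_le hj
    have hdiv : (i * Q + x) / Q = i := by
      rw [mul_comm, Nat.mul_add_div (by omega), Nat.div_eq_of_lt hxQ, add_zero]
    have hmod : (i * Q + x) % Q = x := by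
      rw [mul_comm, Nat.mul_add_mod, Nat.mod_eq_of_lt hxQ]
    rw [hdiv, hmod, smul_eq_mul]
  have hstages : ∀ i, ∑ l ∈ Finset.range (i * Q),
      (φ (l % Q) u • (β (l / Q + 1) - β (l / Q)) (v (l % Q))) • fderiv ℝ (σ (l % Q)) u =
      β i - β 0 := by
    intro i
    induction i with
    | zero => simp
    | succ i ih =>
      rw [Nat.succ_mul, Finset.sum_range_add, ih, hblock i le_rfl, hfull]
      abel
  rw [Finset.sum_range_add, hstages, hblock i hj]

end Telescoping

/-- (Decomposition into primitive 1-forms, Euclidean version of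
Lemma EM2.)  A continuous family of contact forms `α_t` on `U` can, over a compact
`A ⊆ U`, be written as `α_t = α_0 + Σ_l r^l_t d s^l_t` with `r^l_t, s^l_t` compactly
supported in coordinate balls, continuously depending on `t`, and with all partial sums
contact on `A`; if `α_t = α_0` near a compact `V₀ ⊆ A`, the `r^l_t, s^l_t` can be chosen
to vanish on a fixed neighbourhood of `V₀`. -/
theorem contact_form_family_primitive_decomposition
    (n : ℕ) (hn : 0 < n)
    (U : Set (EucOdd n)) (hU : IsOpen U)
    (A : Set (EucOdd n)) (hA : IsCompact A) (hAU : A ⊆ U)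
    (α : ℝ → EucOdd n → (EucOdd n →L[ℝ] ℝ))
    (hsm : ∀ t ∈ Set.Icc (0:ℝ) 1, ContDiffOn ℝ (⊤ : ℕ∞) (α t) U)
    (hck : ∀ k : ℕ, ContinuousOn
      (fun q : ℝ × EucOdd n => iteratedFDeriv ℝ k (α q.1) q.2) (Set.Icc 0 1 ×ˢ U))
    (hcontact : ∀ t ∈ Set.Icc (0:ℝ) 1, ∀ u ∈ U, IsContactFormAt n (α t) u)
    -- data for the relative ("moreover") part; take `V₀ = W = ∅` for the absolute part:
    (V₀ : Set (EucOdd n)) (hV₀ : IsCompact V₀) (hV₀A : V₀ ⊆ A)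
    (W : Set (EucOdd n)) (hW : IsOpen W) (hV₀W : V₀ ⊆ W)
    (hαW : ∀ t ∈ Set.Icc (0:ℝ) 1, ∀ u ∈ W, α t u = α 0 u) :
    ∃ (N : ℕ) (c : ℕ → EucOdd n) (ρ : ℕ → ℝ) (r s : ℕ → ℝ → EucOdd n → ℝ),
      (∀ l < N, 0 < ρ l ∧ closure (Metric.ball (c l) (ρ l)) ⊆ U) ∧
      -- joint continuity in `(t, u)` of `r`, `s` and all their spatial derivatives
      (∀ l < N, ∀ k : ℕ, ContinuousOn
        (fun q : ℝ × EucOdd n => iteratedFDeriv ℝ k (r l q.1) q.2)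
        (Set.Icc 0 1 ×ˢ Set.univ)) ∧
      (∀ l < N, ∀ k : ℕ, ContinuousOn
        (fun q : ℝ × EucOdd n => iteratedFDeriv ℝ k (s l q.1) q.2)
        (Set.Icc 0 1 ×ˢ Set.univ)) ∧
      -- each `r^l_t`, `s^l_t` is smooth and compactly supported in the ball `B^l`
      (∀ l < N, ∀ t ∈ Set.Icc (0:ℝ) 1, ContDiff ℝ (⊤ : ℕ∞) (r l t) ∧ ContDiff ℝ (⊤ : ℕ∞) (s l t) ∧
        HasCompactSupport (r l t) ∧ HasCompactSupport (s l t) ∧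
        tsupport (r l t) ⊆ Metric.ball (c l) (ρ l) ∧
        tsupport (s l t) ⊆ Metric.ball (c l) (ρ l)) ∧
      -- (1) the decomposition over `A`
      (∀ t ∈ Set.Icc (0:ℝ) 1, ∀ u ∈ A,
        α t u = α 0 u + ∑ l ∈ Finset.range N, r l t u • fderiv ℝ (s l t) u) ∧
      -- (2) every partial sum is a contact form at every point of `A`
      (∀ t ∈ Set.Icc (0:ℝ) 1, ∀ j ≤ N, ∀ u ∈ A,
        IsContactFormAt n
          (fun x => α 0 x + ∑ l ∈ Finset.range j, r l t x • fderiv ℝ (s l t) x) u) ∧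
      -- the relative part: vanishing on a fixed neighbourhood of `V₀`
      (∃ W' : Set (EucOdd n), IsOpen W' ∧ V₀ ⊆ W' ∧
        ∀ l < N, ∀ t ∈ Set.Icc (0:ℝ) 1, ∀ u ∈ W', r l t u = 0 ∧ s l t u = 0) := by
  obtain ⟨O, W', Q, c, ρ, φ, σ, v, ⟨hO, hAO⟩, ⟨hW', hV₀W', hW'W⟩, hdata, hsum⟩ :=
    exists_primitive_partition_nat hA hU hAU hV₀ hW hV₀W
  have hstep : ∀ j ∈ Finset.range (Q + 1), ∀ᶠ δ : ℝ in 𝓝[>] 0,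
      ∀ τ ∈ Icc (0 : ℝ) 1, ∀ t ∈ Icc (0 : ℝ) 1, |t - τ| < δ → ∀ u ∈ A,
      IsContactPair (α τ u + primitivePartialSum φ σ v j u (α t u - α τ u),
        fderiv ℝ (fun y => α τ y + primitivePartialSum φ σ v j y (α t y - α τ y)) u) := by
    intro j hj
    have hj : j ≤ Q := Nat.lt_succ_iff.1 (Finset.mem_range.1 hj)
    obtain ⟨δ, hδ, h⟩ := exists_uniform_contact_step hA hU hAU isCompact_Icc hsm hck
      (fun t ht u hu => hcontact t ht u (hAU hu))
      (contDiff_primitivePartialSum (φ := φ) (σ := σ) v (j := j)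
        (fun x hx => (hdata x (hx.trans_le hj)).2.2.1)
        (fun x hx => (hdata x (hx.trans_le hj)).2.2.2.1))
    filter_upwards [Ioo_mem_nhdsGT hδ] with δ' hδ' τ hτ t ht htτ
    exact h τ hτ t ht (htτ.trans hδ'.2)
  obtain ⟨δ, hδstep, hδ⟩ :=
    (((Filter.eventually_all_finset _).2 hstep).and self_mem_nhdsWithin).exists
  obtain ⟨M, hM⟩ := exists_nat_one_div_lt (show (0 : ℝ) < δ from hδ)
  let τ : ℕ → ℝ → ℝ := fun i t => min t (i / (M + 1))
  have hτ : ∀ i, ∀ t ∈ Icc (0 : ℝ) 1, τ i t ∈ Icc (0 : ℝ) 1 := fun i t ht =>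
    ⟨le_min ht.1 (by positivity), (min_le_left _ _).trans ht.2⟩
  have hτ0 : ∀ t ∈ Icc (0 : ℝ) 1, τ 0 t = 0 := fun t ht => by simp [τ, ht.1]
  have hτM : ∀ t ∈ Icc (0 : ℝ) 1, τ (M + 1) t = t := fun t ht => by
    have : ((M + 1 : ℕ) : ℝ) / (M + 1) = 1 := by
      push_cast
      exact div_self (by positivity)
    simp only [τ, this, min_eq_left ht.2]
  have hτstep : ∀ i t, |τ (i + 1) t - τ i t| < δ := fun i t => by
    refine (abs_min_sub_min_le_max _ _ _ _).trans_lt ?_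
    have : ((i + 1 : ℕ) : ℝ) / (M + 1) - i / (M + 1) = 1 / (M + 1) := by
      push_cast
      ring
    rw [this, sub_self, abs_zero, abs_of_pos (by positivity)]
    exact max_lt hδ hM
  have hτcont : ∀ i, Continuous (τ i) := fun i => by fun_prop
  have hατ : ∀ i k, ContinuousOn
      (fun q : ℝ × EucOdd n => iteratedFDeriv ℝ k (α (τ i q.1)) q.2) (Icc 0 1 ×ˢ U) :=
    fun i k => (hck k).comp (f := fun q : ℝ × EucOdd n => (τ i q.1, q.2))
      (((hτcont i).comp continuous_fst).prodMk continuous_snd).continuousOn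
      fun q hq => ⟨hτ i q.1 hq.1, hq.2⟩
  have hβW : ∀ t ∈ Icc (0 : ℝ) 1, ∀ i, ∀ u ∈ W, α (τ (i + 1) t) u - α (τ i t) u = 0 :=
    fun t ht i u hu => by rw [hαW _ (hτ _ t ht) u hu, hαW _ (hτ _ t ht) u hu, sub_self]
  have hβsm : ∀ l, ∀ t ∈ Icc (0 : ℝ) 1, ContDiffOn ℝ (⊤ : ℕ∞)
      (fun u => (α (τ (l / Q + 1) t) u - α (τ (l / Q) t) u) (v (l % Q))) U := fun l t ht =>
    ((hsm _ (hτ _ t ht)).sub (hsm _ (hτ _ t ht))).clm_apply contDiffOn_const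
  have hβc : ∀ l k, ContinuousOn (fun q : ℝ × EucOdd n => iteratedFDeriv ℝ k
      (fun u => (α (τ (l / Q + 1) q.1) u - α (τ (l / Q) q.1) u) (v (l % Q))) q.2)
      (Icc 0 1 ×ˢ U) := fun l k =>
    continuousOn_iteratedFDeriv_clm_comp_sub hU (ContinuousLinearMap.apply ℝ ℝ (v (l % Q)))
      (f := fun t => α (τ (l / Q + 1) t)) (g := fun t => α (τ (l / Q) t))
      (fun t ht => hsm _ (hτ _ t ht)) (fun t ht => hsm _ (hτ _ t ht)) (hατ _) (hατ _) k
  let r : ℕ → ℝ → EucOdd n → ℝ := fun l t u =>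
    φ (l % Q) u • (α (τ (l / Q + 1) t) u - α (τ (l / Q) t) u) (v (l % Q))
  have hpartial : ∀ t ∈ Icc (0 : ℝ) 1, ∀ u ∈ O, ∀ i, ∀ j ≤ Q,
      α 0 u + ∑ l ∈ Finset.range (i * Q + j), r l t u • fderiv ℝ (σ (l % Q)) u =
        α (τ i t) u + primitivePartialSum φ σ v j u (α (τ (i + 1) t) u - α (τ i t) u) := by
    intro t ht u hu i j hj
    rw [sum_range_mul_add_primitive (fun i => α (τ i t) u) (fun i => ?_) i hj]
    · rw [hτ0 t ht]
      abel
    · rw [primitivePartialSum_apply]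
      exact hsum u hu _ (hβW t ht i u)
  have hmod : ∀ l < (M + 1) * Q, l % Q < Q := fun l hl =>
    Nat.mod_lt _ (Nat.pos_of_ne_zero fun h => by simp [h] at hl)
  have hrsupp : ∀ l t, tsupport (r l t) ⊆ tsupport (φ (l % Q)) := fun l t =>
    tsupport_smul_subset_left _ _
  have hφU : ∀ x < Q, tsupport (φ x) ⊆ U := fun x hx =>
    (hdata x hx).2.2.2.2.1.trans (subset_closure.trans (hdata x hx).2.1)
  have hcompact : ∀ {f : EucOdd n → ℝ} {x : ℕ}, tsupport f ⊆ Metric.ball (c x) (ρ x) →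
      HasCompactSupport f := fun {f} {x} h =>
    Metric.isCompact_of_isClosed_isBounded (isClosed_tsupport f) (Metric.isBounded_ball.subset h)
  refine ⟨(M + 1) * Q, fun l => c (l % Q), fun l => ρ (l % Q), r, fun l _ => σ (l % Q),
    fun l hl => ⟨(hdata _ (hmod l hl)).1, (hdata _ (hmod l hl)).2.1⟩, fun l hl k => ?_,
    fun l hl k => ?_, fun l hl t ht => ?_, fun t ht u hu => ?_, fun t ht j hj u hu => ?_,
    W', hW', hV₀W', fun l hl t ht u hu => ⟨?_, (hdata _ (hmod l hl)).2.2.2.2.2.2 u hu⟩⟩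
  · exact continuousOn_iteratedFDeriv_cutoff_smul
      (f := fun t u => (α (τ (l / Q + 1) t) u - α (τ (l / Q) t) u) (v (l % Q))) hU
      (hdata _ (hmod l hl)).2.2.1 (hφU _ (hmod l hl)) (hβsm l) (hβc l) k
  · exact (((hdata _ (hmod l hl)).2.2.2.1.continuous_iteratedFDeriv (m := k)
      (mod_cast le_top)).comp continuous_snd).continuousOn
  · obtain ⟨-, -, h1, h2, h3, h4, -⟩ := hdata _ (hmod l hl)
    refine ⟨?_, h2, hcompact ((hrsupp l t).trans h3), hcompact h4, (hrsupp l t).trans h3, h4⟩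
    exact contDiff_cutoff_smul hU h1 (hφU _ (hmod l hl)) (hβsm l t ht)
  · have := hpartial t ht u (hAO hu) (M + 1) 0 (Nat.zero_le _)
    rw [add_zero, hτM t ht] at this
    rw [this, primitivePartialSum_apply]
    simp
  · have hjQ : j % Q ≤ Q := by
      rcases Nat.eq_zero_or_pos Q with h | h
      · simp_all
      · exact (Nat.mod_lt _ h).le
    have heq : (fun x => α 0 x + ∑ l ∈ Finset.range j, r l t x • fderiv ℝ (σ (l % Q)) x) =ᶠ[𝓝 u]
        fun x => α (τ (j / Q) t) x + primitivePartialSum φ σ v (j % Q) x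
          (α (τ (j / Q + 1) t) x - α (τ (j / Q) t) x) := by
      filter_upwards [hO.mem_nhds (hAO hu)] with x hx
      rw [← hpartial t ht x hx (j / Q) (j % Q) hjQ, Nat.div_add_mod']
    have hpair := hδstep (j % Q) (Finset.mem_range.2 (Nat.lt_succ_of_le hjQ)) _
      (hτ (j / Q) t ht) _ (hτ (j / Q + 1) t ht) (hτstep _ t) u hu
    rw [← heq.fderiv_eq, ← heq.eq_of_nhds] at hpair
    exact hpair
  · simp only [r, hβW t ht _ u (hW'W hu), zero_apply, smul_zero]
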